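/- arXiv:math/0506515 — 2 statements merged into one kernel-verified Lean document; each statement's English description precedes it below -/
import Mathlib

section
/- Let G be a finite abelian p-group of rank t ≥ 1 and H a maximal (index p) subgroup of G. Then there exist cyclic subgroups G₁, …, G_t of G such that the internal product of G₁, …, G_t is direct and equal to G, and the internal product of H ∩ G₁, …, H ∩ G_t is direct and equal to H. -/
section

variable {G : Type*} [CommGroup G]

theorem iSupIndep_zpowers_of_prod_zpow_eq_one {ι : Type*} [Fintype ι] {g : ι → G}
    (h : ∀ a : ι → ℤ, ∏ j, g j ^ a j = 1 → ∀ i, g i ^ a i = 1) :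
    iSupIndep fun i => Subgroup.zpowers (g i) := by
  classical
  intro i
  rw [Subgroup.disjoint_def]
  rintro x ⟨n, rfl⟩ hx
  have hle : ⨆ j, ⨆ (_ : j ≠ i), Subgroup.zpowers (g j) ≤
      Subgroup.closure (Set.range (Function.update g i 1)) := by
    refine iSup₂_le fun j hj => ?_
    rw [Subgroup.zpowers_le]
    exact Subgroup.subset_closure ⟨j, Function.update_of_ne hj _ _⟩
  obtain ⟨a, ha⟩ := Subgroup.exists_of_mem_closure_range _ _ (hle hx)
  have hterm : ∀ j, Function.update g i 1 j ^ a j = g j ^ Function.update a i 0 j := by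
    intro j
    obtain rfl | hj := eq_or_ne j i <;> simp_all
  have hsingle : ∏ j, g j ^ (Pi.single i n : ι → ℤ) j = g i ^ n := by
    rw [Finset.prod_eq_single i] <;> simp +contextual
  have hrel := h (fun j => (Pi.single i n : ι → ℤ) j - Function.update a i 0 j) (by
    simp only [zpow_sub, ← div_eq_mul_inv, Finset.prod_div_distrib, hsingle, ← hterm, ← ha]
    exact div_self' _) i
  simpa using hrel

theorem Subgroup.mem_of_zpow_mem_of_isCoprime_orderOf {K : Subgroup G} {x : G} {b : ℤ}
    (hb : IsCoprime b (orderOf x)) (hx : x ^ b ∈ K) : x ∈ K := by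
  obtain ⟨u, w, huw⟩ := hb
  have hxu : (x ^ b) ^ u = x := by
    rw [← zpow_mul, mul_comm, eq_sub_of_add_eq huw, zpow_sub, mul_comm w, zpow_mul]
    simp
  exact hxu ▸ K.zpow_mem hx u

theorem Subgroup.closure_range_update_eq_top {ι : Type*} [Fintype ι] [DecidableEq ι] {g : ι → G}
    (hg : Subgroup.closure (Set.range g) = ⊤) {i : ι} {b : ι → ℤ}
    (hb : IsCoprime (b i) (orderOf (g i))) :
    Subgroup.closure (Set.range (Function.update g i (∏ j, g j ^ b j))) = ⊤ := by
  set K := Subgroup.closure (Set.range (Function.update g i (∏ j, g j ^ b j)))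
  have hne : ∀ j, j ≠ i → g j ∈ K := fun j hj =>
    Subgroup.subset_closure ⟨j, Function.update_of_ne hj _ _⟩
  have hprod : ∏ j, g j ^ b j ∈ K := Subgroup.subset_closure ⟨i, Function.update_self _ _ _⟩
  rw [← Finset.mul_prod_erase _ _ (Finset.mem_univ i)] at hprod
  have hi : g i ∈ K := mem_of_zpow_mem_of_isCoprime_orderOf hb <|
    (K.mul_mem_cancel_right (K.prod_mem fun j hj =>
      K.zpow_mem (hne j (Finset.ne_of_mem_erase hj)) _)).1 hprod
  rw [eq_top_iff, ← hg, Subgroup.closure_le]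
  rintro _ ⟨j, rfl⟩
  obtain rfl | hj := eq_or_ne j i
  exacts [hi, hne j hj]

theorem IsPGroup.exists_prod_orderOf_lt {p : ℕ} (hp : p.Prime) [Finite G] (hG : IsPGroup p G)
    {ι : Type*} [Fintype ι] {g : ι → G} (hg : Subgroup.closure (Set.range g) = ⊤)
    {a : ι → ℤ} (ha : ∏ j, g j ^ a j = 1) {i : ι} (hi : g i ^ a i ≠ 1) :
    ∃ g' : ι → G, Subgroup.closure (Set.range g') = ⊤ ∧
      ∏ j, orderOf (g' j) < ∏ j, orderOf (g j) := by
  classical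
  have := Fact.mk hp
  obtain ⟨i₀, hi₀, hmin⟩ := Finset.exists_min_image {j | g j ^ a j ≠ 1}
    (fun j => padicValInt p (a j)) ⟨i, by simpa using hi⟩
  simp only [Finset.mem_filter, Finset.mem_univ, true_and] at hi₀ hmin
  set v := padicValInt p (a i₀) with hv
  have ha₀ : a i₀ ≠ 0 := by
    intro h
    simp [h] at hi₀
  have hdvd : ∀ j, ∃ c : ℤ, g j ^ a j ≠ 1 → a j = p ^ v * c := by
    intro j
    by_cases hj : g j ^ a j = 1
    · exact ⟨0, fun h => absurd hj h⟩
    · obtain ⟨c, hc⟩ := (pow_dvd_pow (p : ℤ) (hmin j hj)).trans (padicValInt_dvd (a j))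
      exact ⟨c, fun _ => hc⟩
  choose c hc using hdvd
  set b : ι → ℤ := fun j => if g j ^ a j = 1 then 0 else c j with hbdef
  have hterm : ∀ j, (g j ^ b j) ^ p ^ v = g j ^ a j := by
    intro j
    by_cases hj : g j ^ a j = 1
    · simp [hbdef, hj]
    · simp only [hbdef, hj, if_false]
      rw [hc j hj, mul_comm, zpow_mul, ← zpow_natCast]
      push_cast
      rfl
  have hb₀ : b i₀ = c i₀ := by simp [hbdef, hi₀]
  have hpc : ¬ (p : ℤ) ∣ c i₀ := by
    rintro ⟨d, hd⟩
    have h : (p : ℤ) ^ (v + 1) ∣ a i₀ := ⟨d, by rw [hc i₀ hi₀, hd]; ring⟩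
    rw [padicValInt_dvd_iff] at h
    omega
  obtain ⟨k, hk⟩ := IsPGroup.exists_orderOf_eq_pow hG (g i₀)
  have hcop : IsCoprime (b i₀) (orderOf (g i₀)) := by
    rw [hb₀, hk]
    push_cast
    exact (((Nat.prime_iff_prime_int.1 hp).coprime_iff_not_dvd.2 hpc).symm).pow_right
  refine ⟨_, Subgroup.closure_range_update_eq_top hg hcop, ?_⟩
  have hpow : (∏ j, g j ^ b j) ^ p ^ v = 1 := by
    rw [← Finset.prod_pow, ← ha]
    exact Finset.prod_congr rfl fun j _ => hterm j
  have hvk : v < k := by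
    by_contra! hkv
    refine hi₀ ?_
    rw [← hterm i₀, ← zpow_natCast, zpow_comm, zpow_natCast,
      orderOf_dvd_iff_pow_eq_one.1 (hk ▸ pow_dvd_pow p hkv), one_zpow]
  have hlt : orderOf (∏ j, g j ^ b j) < orderOf (g i₀) :=
    (orderOf_le_of_pow_eq_one (pow_pos hp.pos v) hpow).trans_lt
      (hk ▸ Nat.pow_lt_pow_right hp.one_lt hvk)
  refine Finset.prod_lt_prod (fun j _ => orderOf_pos _) (fun j _ => ?_)
    ⟨i₀, Finset.mem_univ _, by simpa using hlt⟩
  obtain rfl | hj := eq_or_ne j i₀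
  · simpa using hlt.le
  · simp [hj]

theorem Subgroup.exists_mul_pow_mem_of_index_prime {H : Subgroup G} (hH : H.index.Prime)
    {x : G} (hx : x ∉ H) (y : G) : ∃ n : ℤ, y * x ^ n ∈ H := by
  have := Fact.mk hH
  obtain ⟨n, hn⟩ := mem_zpowers_of_prime_card (p := H.index) (G := G ⧸ H) rfl
    (g := (x : G ⧸ H)) (g' := ((y⁻¹ : G) : G ⧸ H)) (by simpa using hx)
  refine ⟨n, ?_⟩
  have h : ((y⁻¹ : G) : G ⧸ H) = ((x ^ n : G) : G ⧸ H) := by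
    rw [← hn]
    rfl
  simpa using QuotientGroup.eq.1 h

theorem IsPGroup.exists_generators_prod_orderOf_le {p : ℕ} (hp : p.Prime) [Finite G]
    (hG : IsPGroup p G) {H : Subgroup G} (hH : H.index = p)
    {ι : Type*} [Fintype ι] {g : ι → G} (hg : Subgroup.closure (Set.range g) = ⊤) :
    ∃ (g' : ι → G) (i₀ : ι), Subgroup.closure (Set.range g') = ⊤ ∧
      ∏ j, orderOf (g' j) ≤ ∏ j, orderOf (g j) ∧ ∀ j ≠ i₀, g' j ∈ H := by
  classical
  have := Fact.mk hp
  have hex : ∃ i, g i ∉ H := by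
    by_contra! h
    have htop : H = ⊤ := by
      rw [eq_top_iff, ← hg, Subgroup.closure_le]
      rintro _ ⟨j, rfl⟩
      exact h j
    rw [htop, Subgroup.index_top] at hH
    exact hp.one_lt.ne hH
  obtain ⟨i, hi⟩ := hex
  obtain ⟨i₀, hi₀, hmin⟩ := Finset.exists_min_image {j | g j ∉ H}
    (fun j => orderOf (g j)) ⟨i, by simpa using hi⟩
  simp only [Finset.mem_filter, Finset.mem_univ, true_and] at hi₀ hmin
  have hcorr : ∀ j, ∃ n : ℤ, g j * g i₀ ^ n ∈ H ∧ orderOf (g j * g i₀ ^ n) ≤ orderOf (g j) := by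
    intro j
    by_cases hj : g j ∈ H
    · exact ⟨0, by simpa using hj, by simp⟩
    obtain ⟨n, hn⟩ := Subgroup.exists_mul_pow_mem_of_index_prime (hH ▸ hp) hi₀ (g j)
    refine ⟨n, hn, orderOf_le_of_pow_eq_one (orderOf_pos _) ?_⟩
    obtain ⟨k, hk⟩ := IsPGroup.exists_orderOf_eq_pow hG (g i₀)
    obtain ⟨l, hl⟩ := IsPGroup.exists_orderOf_eq_pow hG (g j)
    have hdvd : orderOf (g i₀) ∣ orderOf (g j) := by
      have hle := hmin j hj
      rw [hk, hl] at hle ⊢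
      exact pow_dvd_pow p ((Nat.pow_le_pow_iff_right hp.one_lt).1 hle)
    rw [mul_pow, pow_orderOf_eq_one, one_mul, ← zpow_natCast, zpow_comm, zpow_natCast,
      orderOf_dvd_iff_pow_eq_one.1 hdvd, one_zpow]
  choose n hn hord using hcorr
  refine ⟨fun j => if j = i₀ then g i₀ else g j * g i₀ ^ n j, i₀, ?_, ?_, ?_⟩
  · set K := Subgroup.closure (Set.range fun j => if j = i₀ then g i₀ else g j * g i₀ ^ n j)
    have hK₀ : g i₀ ∈ K := Subgroup.subset_closure ⟨i₀, by simp⟩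
    rw [eq_top_iff, ← hg, Subgroup.closure_le]
    rintro _ ⟨j, rfl⟩
    obtain rfl | hj := eq_or_ne j i₀
    · exact hK₀
    · exact (K.mul_mem_cancel_right (K.zpow_mem hK₀ (n j))).1
        (Subgroup.subset_closure ⟨j, by simp [hj]⟩)
  · refine Finset.prod_le_prod' fun j _ => ?_
    obtain rfl | hj := eq_or_ne j i₀
    · simp
    · simpa [hj] using hord j
  · intro j hj
    simpa [hj] using hn j

theorem Subgroup.iSup_inf_eq_of_forall_ne_le {ι : Type*} {H : Subgroup G} {C : ι → Subgroup G}
    (hC : ⨆ i, C i = ⊤) {i₀ : ι} (h : ∀ j ≠ i₀, C j ≤ H) : ⨆ i, H ⊓ C i = H := by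
  refine le_antisymm (iSup_le fun i => inf_le_left) ?_
  have hle : ⨆ j, ⨆ (_ : j ≠ i₀), C j ≤ H := iSup₂_le h
  calc H = ((⨆ j, ⨆ (_ : j ≠ i₀), C j) ⊔ C i₀) ⊓ H := by
        rw [sup_comm, ← iSup_split_single C i₀, hC, top_inf_eq]
    _ = (⨆ j, ⨆ (_ : j ≠ i₀), C j) ⊔ C i₀ ⊓ H := (sup_inf_assoc_of_le _ hle)
    _ ≤ ⨆ i, H ⊓ C i := by
      refine sup_le (iSup₂_le fun j hj => ?_) ?_
      · exact (le_inf (h j hj) le_rfl).trans (le_iSup (fun i => H ⊓ C i) j)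
      · exact (inf_comm _ _).le.trans (le_iSup (fun i => H ⊓ C i) i₀)

theorem Group.exists_fin_closure_range_eq_top (G : Type*) [Group G] [Group.FG G] {t : ℕ}
    (ht : Group.rank G = t) : ∃ g : Fin t → G, Subgroup.closure (Set.range g) = ⊤ := by
  obtain ⟨S, hcard, hS⟩ := Group.rank_spec G
  refine ⟨fun i => (S.equivFinOfCardEq (hcard.trans ht)).symm i, ?_⟩
  rw [← hS]
  congr 1
  change Set.range (Subtype.val ∘ (S.equivFinOfCardEq (hcard.trans ht)).symm) = _
  rw [EquivLike.range_comp]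
  simp

end


/-- Statement (6.1): Let `G` be a finite abelian `p`-group of rank `t ≥ 1` and `H` a
maximal subgroup of `G` (i.e. a subgroup of index `p`).  Then there exist cyclic
subgroups `G₁, …, G_t` of `G` whose internal product is direct and equal to `G`, and
such that the internal product of `H ⊓ G₁, …, H ⊓ G_t` is direct and equal to `H`. -/
theorem abelian_pGroup_basis_adapted_to_maximal_subgroup
    (p : ℕ) (hp : p.Prime) (G : Type*) [CommGroup G] [Finite G]
    (hG : IsPGroup p G) (t : ℕ) (ht : 1 ≤ t) (hrank : Group.rank G = t)
    (H : Subgroup G) (hH : H.index = p) :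
    ∃ C : Fin t → Subgroup G,
      (∀ i, IsCyclic (C i)) ∧
      iSupIndep C ∧ (⨆ i, C i) = ⊤ ∧
      iSupIndep (fun i => H ⊓ C i) ∧ (⨆ i, H ⊓ C i) = H := by
  obtain ⟨g₁, hg₁, hmin⟩ := Set.exists_min_image
    {g : Fin t → G | Subgroup.closure (Set.range g) = ⊤} (fun g => ∏ j, orderOf (g j))
    (Set.toFinite _) (Group.exists_fin_closure_range_eq_top G hrank)
  obtain ⟨g, i₀, hg, hle, hgH⟩ := hG.exists_generators_prod_orderOf_le hp hH hg₁
  have hind : iSupIndep fun i => Subgroup.zpowers (g i) := by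
    refine iSupIndep_zpowers_of_prod_zpow_eq_one fun a ha i => ?_
    by_contra hi
    obtain ⟨g₂, hg₂, hlt⟩ := hG.exists_prod_orderOf_lt hp hg ha hi
    exact (hlt.trans_le (hle.trans (hmin g₂ hg₂))).false
  have htop : ⨆ i, Subgroup.zpowers (g i) = ⊤ := by
    rw [eq_top_iff, ← hg, Subgroup.closure_le]
    rintro _ ⟨j, rfl⟩
    exact Subgroup.mem_iSup_of_mem j (Subgroup.mem_zpowers (g j))
  exact ⟨fun i => Subgroup.zpowers (g i), fun i => inferInstance, hind, htop,
    hind.mono fun i => inf_le_right,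
    Subgroup.iSup_inf_eq_of_forall_ne_le htop fun j hj => Subgroup.zpowers_le.2 (hgH j hj)⟩
end

section
/- Let G be a finite abelian p-group with ordered basis h = {h₁, …, h_t} (t ≥ 2). Then the automorphism group Aut(G) is generated by the 'diagonal' automorphisms d(k,m;h) (sending h_k to h_k^m for m coprime to the order of h_k and fixing the other basis elements) and the 'transvection' automorphisms t(i,j,s;h) (sending h_j to h_j·h_i^s where max{1, o(h_i)/o(h_j)} divides s and 1 ≤ s < o(h_i), fixing the other basis elements), taken over all ordered bases h of G. -/
/-- An ordered basis of a finite abelian `p`-group: a tuple whose cyclic subgroups form an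
internal direct product equal to the whole group, with (weakly) decreasing orders. -/
def IsOrderedBasis {G : Type*} [CommGroup G] {t : ℕ} (h : Fin t → G) : Prop :=
  iSupIndep (fun i => Subgroup.zpowers (h i)) ∧
  (⨆ i, Subgroup.zpowers (h i)) = ⊤ ∧
  ∀ i j : Fin t, i ≤ j → orderOf (h j) ≤ orderOf (h i)

/-- The set of "diagonal" and "transvection" automorphisms with respect to all ordered
bases of `G`, as in (6.3):  `d(k,m;h)` sends `h k` to `h k ^ m` (`1 < m < o(h k)`,
`gcd (m, o(h k)) = 1`) fixing the other basis elements, and `t(i,j,s;h)` sends `h j` to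
`h j * h i ^ s` (`i ≠ j`, `1 ≤ s < o(h i)`, `max 1 (o(h i)/o(h j)) ∣ s`) fixing the other
basis elements. -/
def diagAndTransvections (G : Type*) [CommGroup G] : Set (MulAut G) :=
  {φ : MulAut G | ∃ (t : ℕ) (h : Fin t → G), IsOrderedBasis h ∧
    ((∃ (k : Fin t) (m : ℕ), 1 < m ∧ m < orderOf (h k) ∧ Nat.Coprime m (orderOf (h k)) ∧
        φ (h k) = h k ^ m ∧ ∀ k' : Fin t, k' ≠ k → φ (h k') = h k') ∨
     (∃ (i j : Fin t) (s : ℕ), i ≠ j ∧ 1 ≤ s ∧ s < orderOf (h i) ∧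
        (max 1 (orderOf (h i) / orderOf (h j))) ∣ s ∧
        φ (h j) = h j * h i ^ s ∧ ∀ j' : Fin t, j' ≠ j → φ (h j') = h j'))}

namespace IsOrderedBasis

variable {G : Type*} [CommGroup G] {t : ℕ} {h : Fin t → G}

theorem pairwise_commute_zpowers (h : Fin t → G) : Pairwise fun i j =>
    ∀ x y : G, x ∈ Subgroup.zpowers (h i) → y ∈ Subgroup.zpowers (h j) → Commute x y :=
  fun _ _ _ x y _ _ => Commute.all x y

theorem bijective_noncommPiCoprod (hb : IsOrderedBasis h) :
    Function.Bijective (Subgroup.noncommPiCoprod (pairwise_commute_zpowers h)) := by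
  refine ⟨Subgroup.injective_noncommPiCoprod_of_iSupIndep hb.1, ?_⟩
  rw [← MonoidHom.range_eq_top, Subgroup.noncommPiCoprod_range]
  exact hb.2.1

theorem exists_eq_prod_pow [Finite G] (hb : IsOrderedBasis h) (y : G) :
    ∃ a : Fin t → ℕ, y = ∏ i, h i ^ a i := by
  obtain ⟨u, rfl⟩ := hb.bijective_noncommPiCoprod.2 y
  have hu : ∀ i, ∃ n : ℕ, h i ^ n = u i := fun i =>
    Submonoid.mem_powers_iff _ _ |>.1 (mem_powers_iff_mem_zpowers.2 (u i).2)
  choose a ha using hu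
  exact ⟨a, by simp [Subgroup.noncommPiCoprod_apply, Finset.noncommProd_eq_prod, ha]⟩

/-- A homomorphism may be prescribed on a basis, as long as the orders allow it. -/
theorem exists_monoidHom (hb : IsOrderedBasis h) (g : Fin t → G)
    (hg : ∀ i, orderOf (g i) ∣ orderOf (h i)) : ∃ f : G →* G, ∀ i, f (h i) = g i := by
  let e := MulEquiv.ofBijective _ hb.bijective_noncommPiCoprod
  have gen : ∀ i, ∀ x : Subgroup.zpowers (h i),
      x ∈ Subgroup.zpowers (⟨h i, Subgroup.mem_zpowers (h i)⟩ : Subgroup.zpowers (h i)) := by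
    rintro i ⟨x, n, rfl⟩
    exact ⟨n, rfl⟩
  have hord : ∀ i, orderOf (g i) ∣
      orderOf (⟨h i, Subgroup.mem_zpowers (h i)⟩ : Subgroup.zpowers (h i)) := fun i => by
    simpa only [Subgroup.orderOf_mk] using hg i
  let ϕ : ∀ i, Subgroup.zpowers (h i) →* G := fun i =>
    monoidHomOfForallMemZpowers (gen i) (hord i)
  have hcomm : Pairwise fun i j => ∀ x y, Commute (ϕ i x) (ϕ j y) :=
    fun _ _ _ _ _ => Commute.all _ _
  let F := MonoidHom.noncommPiCoprod ϕ hcomm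
  refine ⟨F.comp e.symm.toMonoidHom, fun i => ?_⟩
  have he : e.symm (h i) = Pi.mulSingle i ⟨h i, Subgroup.mem_zpowers (h i)⟩ := by
    rw [MulEquiv.symm_apply_eq]
    exact (Subgroup.noncommPiCoprod_mulSingle (hcomm := pairwise_commute_zpowers h) i ⟨h i, Subgroup.mem_zpowers (h i)⟩).symm
  change F (e.symm (h i)) = g i
  rw [he]
  exact (MonoidHom.noncommPiCoprod_mulSingle ϕ (hcomm := hcomm) i _).trans
    (monoidHomOfForallMemZpowers_apply_gen (gen i) (hord i))

theorem pow_eq_pow_of_prod_eq (hb : IsOrderedBasis h) {a b : Fin t → ℕ}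
    (hab : ∏ i, h i ^ a i = ∏ i, h i ^ b i) (k : Fin t) : h k ^ a k = h k ^ b k := by
  obtain ⟨f, hf⟩ := hb.exists_monoidHom (fun i => if i = k then h k else 1)
    (fun i => by split_ifs with hi <;> simp [hi])
  simpa [hf, ite_pow] using congrArg f hab

theorem monoidHom_ext [Finite G] (hb : IsOrderedBasis h) {f g : G →* G}
    (hfg : ∀ i, f (h i) = g (h i)) : f = g := by
  ext y
  obtain ⟨a, rfl⟩ := hb.exists_eq_prod_pow y
  simp [hfg]

theorem exists_mulAut [Finite G] (hb : IsOrderedBasis h) (g : Fin t → G)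
    (hg : ∀ i, orderOf (g i) ∣ orderOf (h i)) (hgen : ∀ i, h i ∈ Subgroup.closure (Set.range g)) :
    ∃ φ : MulAut G, ∀ i, φ (h i) = g i := by
  obtain ⟨f, hf⟩ := hb.exists_monoidHom g hg
  have hsurj : Function.Surjective f := by
    rw [← MonoidHom.range_eq_top, ← top_le_iff, ← hb.2.1, iSup_le_iff]
    intro i
    rw [Subgroup.zpowers_le]
    refine (Subgroup.closure_le _).2 ?_ (hgen i)
    rintro _ ⟨j, rfl⟩
    exact ⟨h j, hf j⟩
  exact ⟨MulEquiv.ofBijective f (Finite.injective_iff_bijective.1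
    (Finite.injective_iff_surjective.2 hsurj)), hf⟩

theorem exists_mulAut_update [Finite G] (hb : IsOrderedBasis h) (k : Fin t) (x : G)
    (hx : orderOf x ∣ orderOf (h k))
    (hk : h k ∈ Subgroup.closure (Set.range (Function.update h k x))) :
    ∃ φ : MulAut G, φ (h k) = x ∧ ∀ j, j ≠ k → φ (h j) = h j := by
  obtain ⟨φ, hφ⟩ := hb.exists_mulAut (Function.update h k x)
    (fun i => by
      obtain rfl | hi := eq_or_ne i k
      · simpa using hx
      · simp [hi])
    (fun i => by
      obtain rfl | hi := eq_or_ne i k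
      · exact hk
      · exact Subgroup.subset_closure ⟨i, by simp [hi]⟩)
  exact ⟨φ, by simp [hφ], fun j hj => by simp [hφ, hj]⟩

/-- The diagonal automorphisms, without the normalisation of the exponent. -/
theorem exists_diagonal_mem_closure [Finite G] (hb : IsOrderedBasis h) (k : Fin t) {m : ℕ}
    (hm : m.Coprime (orderOf (h k))) :
    ∃ ψ ∈ Subgroup.closure (diagAndTransvections G),
      ψ (h k) = h k ^ m ∧ ∀ j, j ≠ k → ψ (h j) = h j := by
  by_cases h1 : h k ^ m = h k
  · exact ⟨1, one_mem _, by simp [h1], by simp⟩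
  have hm' : (m % orderOf (h k)).Coprime (orderOf (h k)) :=
    (Nat.mod_modEq m _).gcd_eq.trans hm
  have hpos := orderOf_pos (h k)
  obtain ⟨φ, hφ, hφ'⟩ := hb.exists_mulAut_update k (h k ^ m) (orderOf_pow_dvd m) (by
    have : h k ^ m ∈ Subgroup.closure (Set.range (Function.update h k (h k ^ m))) :=
      Subgroup.subset_closure ⟨k, by simp⟩
    obtain ⟨n, hn⟩ := exists_pow_eq_self_of_coprime hm
    have hpow := pow_mem this n
    rwa [hn] at hpow)
  refine ⟨φ, Subgroup.subset_closure ⟨t, h, hb, Or.inl ⟨k, m % orderOf (h k), ?_,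
    Nat.mod_lt _ hpos, hm', by rw [hφ, pow_mod_orderOf], hφ'⟩⟩, hφ, hφ'⟩
  by_contra! hle
  rw [← pow_mod_orderOf] at h1
  interval_cases hr : m % orderOf (h k)
  · rw [Nat.coprime_zero_left, orderOf_eq_one_iff] at hm'
    simp [hm'] at h1
  · simp at h1

/-- The transvections, without the normalisation of the exponent. -/
theorem exists_transvection_mem_closure [Finite G] {p : ℕ} (hp : p.Prime) (hG : IsPGroup p G)
    (hb : IsOrderedBasis h) {i j : Fin t} (hij : i ≠ j) {s : ℕ}
    (hs : (h i ^ s) ^ orderOf (h j) = 1) :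
    ∃ ψ ∈ Subgroup.closure (diagAndTransvections G),
      ψ (h j) = h j * h i ^ s ∧ ∀ l, l ≠ j → ψ (h l) = h l := by
  have := Fact.mk hp
  by_cases h1 : h i ^ s = 1
  · exact ⟨1, one_mem _, by simp [h1], by simp⟩
  have hpos := orderOf_pos (h i)
  obtain ⟨φ, hφ, hφ'⟩ := hb.exists_mulAut_update j (h j * h i ^ s)
    (orderOf_dvd_of_pow_eq_one (by rw [mul_pow, pow_orderOf_eq_one, hs, one_mul])) (by
      have hj : h j * h i ^ s ∈
          Subgroup.closure (Set.range (Function.update h j (h j * h i ^ s))) :=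
        Subgroup.subset_closure ⟨j, by simp⟩
      have hi : h i ∈ Subgroup.closure (Set.range (Function.update h j (h j * h i ^ s))) :=
        Subgroup.subset_closure ⟨i, by simp [hij]⟩
      simpa using mul_mem hj (inv_mem (pow_mem hi s)))
  refine ⟨φ, Subgroup.subset_closure ⟨t, h, hb, Or.inr ⟨i, j, s % orderOf (h i), hij, ?_,
    Nat.mod_lt _ hpos, ?_, by rw [hφ, pow_mod_orderOf], hφ'⟩⟩, hφ, hφ'⟩
  · rw [Nat.one_le_iff_ne_zero]
    intro h0
    rw [← pow_mod_orderOf, h0, pow_zero] at h1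
    exact h1 rfl
  · rw [← pow_mul] at hs
    replace hs := orderOf_dvd_of_pow_eq_one hs
    obtain ⟨a, ha⟩ := hG.exists_orderOf_eq_pow (h i)
    obtain ⟨b, hb'⟩ := hG.exists_orderOf_eq_pow (h j)
    rw [ha, hb'] at hs ⊢
    obtain hab | hab := le_total a b
    · have : p ^ a / p ^ b ≤ 1 :=
        (Nat.div_le_div_right (Nat.pow_le_pow_right hp.pos hab)).trans
          (Nat.div_self (pow_pos hp.pos b)).le
      rw [max_eq_left this]
      exact one_dvd _
    · obtain ⟨c, rfl⟩ := Nat.exists_eq_add_of_le hab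
      rw [pow_add, Nat.mul_div_cancel_left _ (pow_pos hp.pos b),
        max_eq_right (Nat.one_le_pow _ _ hp.pos)]
      rw [pow_add, mul_comm s] at hs
      exact (Nat.dvd_mod_iff (Dvd.intro_left _ rfl)).2
        (Nat.dvd_of_mul_dvd_mul_left (pow_pos hp.pos b) hs)

/-- Any `y` of order dividing that of `h k` whose `k`-th coordinate is a unit is the image of `h k`
under a product of diagonals and transvections fixing the other basis elements. -/
theorem exists_mem_closure_map_eq [Finite G] {p : ℕ} (hp : p.Prime) (hG : IsPGroup p G)
    (hb : IsOrderedBasis h) (k : Fin t) (a : Fin t → ℕ) (hk : (a k).Coprime (orderOf (h k)))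
    (ha : (∏ i, h i ^ a i) ^ orderOf (h k) = 1) :
    ∃ ψ ∈ Subgroup.closure (diagAndTransvections G),
      ψ (h k) = ∏ i, h i ^ a i ∧ ∀ j, j ≠ k → ψ (h j) = h j := by
  have hcoord : ∀ i, (h i ^ a i) ^ orderOf (h k) = 1 := fun i => by
    have := hb.pow_eq_pow_of_prod_eq (a := fun i => a i * orderOf (h k)) (b := fun _ => 0)
      (by simpa [pow_mul, Finset.prod_pow] using ha) i
    simpa [pow_mul] using this
  have key : ∀ s : Finset (Fin t), k ∉ s → ∃ ψ ∈ Subgroup.closure (diagAndTransvections G),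
      ψ (h k) = h k * ∏ i ∈ s, h i ^ a i ∧ ∀ j, j ≠ k → ψ (h j) = h j := by
    intro s
    induction s using Finset.induction_on with
    | empty => exact fun _ => ⟨1, one_mem _, by simp, by simp⟩
    | insert i s hi ih =>
      intro hks
      rw [Finset.mem_insert, not_or] at hks
      obtain ⟨ψ, hψ, hψk, hψj⟩ := ih hks.2
      obtain ⟨τ, hτ, hτk, hτj⟩ :=
        hb.exists_transvection_mem_closure hp hG (Ne.symm hks.1) (hcoord i)
      refine ⟨ψ * τ, mul_mem hψ hτ, ?_, fun j hj => ?_⟩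
      · rw [MulAut.mul_apply, hτk, map_mul, map_pow, hψk, hψj i (Ne.symm hks.1),
          Finset.prod_insert hi, mul_assoc, mul_comm (∏ i ∈ s, h i ^ a i)]
      · rw [MulAut.mul_apply, hτj j hj, hψj j hj]
  obtain ⟨ψ, hψ, hψk, hψj⟩ := key (Finset.univ.erase k) (Finset.notMem_erase k _)
  obtain ⟨δ, hδ, hδk, hδj⟩ := hb.exists_diagonal_mem_closure k hk
  refine ⟨δ * ψ, mul_mem hδ hψ, ?_, fun j hj => ?_⟩
  · rw [MulAut.mul_apply, hψk, map_mul, hδk, map_prod,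
      ← Finset.mul_prod_erase _ _ (Finset.mem_univ k)]
    congr 1
    refine Finset.prod_congr rfl fun i hi => ?_
    rw [map_pow, hδj i (Finset.ne_of_mem_erase hi)]
  · rw [MulAut.mul_apply, hψj j hj, hδj j hj]

theorem exists_coprime_coord [Finite G] {p : ℕ} (hp : p.Prime) (hG : IsPGroup p G)
    (hb : IsOrderedBasis h) {k : Fin t} (hk : h k ≠ 1) {φ : MulAut G}
    (hφ : ∀ j < k, φ (h j) = h j) {a : Fin t → ℕ} (ha : φ (h k) = ∏ i, h i ^ a i) :
    ∃ i, k ≤ i ∧ orderOf (h i) = orderOf (h k) ∧ p.Coprime (a i) := by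
  have := Fact.mk hp
  by_contra! H
  obtain ⟨e, he⟩ := hG.exists_orderOf_eq_pow (h k)
  obtain _ | e := e
  · rw [pow_zero, orderOf_eq_one_iff] at he
    exact hk he
  have hvanish : ∀ i, k ≤ i → (h i ^ a i) ^ p ^ e = 1 := by
    intro i hi
    obtain ⟨d, hd⟩ := hG.exists_orderOf_eq_pow (h i)
    have hle := hb.2.2 k i hi
    rw [← pow_mul, ← orderOf_dvd_iff_pow_eq_one, hd]
    rw [hd, he, Nat.pow_le_pow_iff_right hp.one_lt] at hle
    obtain rfl | hlt := hle.eq_or_lt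
    · obtain ⟨c, hc⟩ := (Nat.coprime_or_dvd_of_prime hp (a i)).resolve_left
        (H i hi (hd.trans he.symm))
      exact ⟨c, by rw [hc]; ring⟩
    · exact (pow_dvd_pow p (Nat.le_of_lt_succ hlt)).mul_left _
  have hpow : h k ^ p ^ e = ∏ i, h i ^ (if i < k then a i * p ^ e else 0) := by
    apply φ.injective
    rw [map_pow, ha, map_prod, ← Finset.prod_pow]
    refine Finset.prod_congr rfl fun i _ => ?_
    split_ifs with hi
    · rw [map_pow, hφ i hi, pow_mul]
    · simpa using hvanish i (not_lt.1 hi)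
  have hone := hb.pow_eq_pow_of_prod_eq (a := fun i => if i = k then p ^ e else 0)
    (b := fun i => if i < k then a i * p ^ e else 0)
    (by rw [← hpow]; simp [pow_ite]) k
  simp only [if_true, lt_irrefl, if_false, pow_zero] at hone
  have hdvd := orderOf_dvd_of_pow_eq_one hone
  rw [he, Nat.pow_dvd_pow_iff_le_right hp.one_lt] at hdvd
  omega

theorem exists_mem_closure_mul_fixes [Finite G] {p : ℕ} (hp : p.Prime) (hG : IsPGroup p G)
    (hb : IsOrderedBasis h) (k : Fin t) {φ : MulAut G} (hφ : ∀ j < k, φ (h j) = h j) :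
    ∃ ψ ∈ Subgroup.closure (diagAndTransvections G), ∀ j ≤ k, (ψ * φ) (h j) = h j := by
  have := Fact.mk hp
  by_cases h1 : h k = 1
  · refine ⟨1, one_mem _, fun j hj => ?_⟩
    obtain rfl | hlt := hj.eq_or_lt
    · simp [h1]
    · simpa using hφ j hlt
  suffices ∃ τ ∈ Subgroup.closure (diagAndTransvections G), (∀ j < k, τ (h j) = h j) ∧
      ∃ b : Fin t → ℕ, τ (φ (h k)) = ∏ i, h i ^ b i ∧ p.Coprime (b k) by
    obtain ⟨τ, hτ, hτj, b, hb', hcop⟩ := this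
    obtain ⟨ψ, hψ, hψk, hψj⟩ := hb.exists_mem_closure_map_eq hp hG k b
      (by
        obtain ⟨e, he⟩ := hG.exists_orderOf_eq_pow (h k)
        rw [he]
        exact hcop.symm.pow_right e)
      (by rw [← hb', ← map_pow, ← map_pow, pow_orderOf_eq_one, map_one, map_one])
    refine ⟨ψ⁻¹ * τ, mul_mem (inv_mem hψ) hτ, fun j hj => ?_⟩
    rw [mul_assoc, MulAut.mul_apply, MulAut.mul_apply, MulAut.inv_apply, MulEquiv.symm_apply_eq]
    obtain rfl | hlt := hj.eq_or_lt
    · rw [hb', hψk]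
    · rw [hφ j hlt, hτj j hlt, hψj j hlt.ne]
  obtain ⟨a, ha⟩ := hb.exists_eq_prod_pow (φ (h k))
  by_cases hak : p.Coprime (a k)
  · exact ⟨1, one_mem _, by simp, a, by simpa using ha, hak⟩
  obtain ⟨i, hki, hord, hai⟩ := hb.exists_coprime_coord hp hG h1 hφ ha
  have hne : k ≠ i := by
    rintro rfl
    exact hak hai
  obtain ⟨τ, hτ, hτi, hτj⟩ := hb.exists_transvection_mem_closure hp hG hne (s := 1)
    (by rw [hord, pow_one, pow_orderOf_eq_one])
  refine ⟨τ, hτ, fun j hj => hτj j (hj.trans_le hki).ne,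
    fun j => a j + if j = k then a i else 0, ?_, ?_⟩
  · have hτ' : ∀ j, τ (h j) = h j * if j = i then h k else 1 := fun j => by
      split_ifs with hj
      · rw [hj, hτi, pow_one]
      · rw [hτj j hj, mul_one]
    simp only [ha, map_prod, map_pow, hτ', mul_pow, pow_add, Finset.prod_mul_distrib]
    simp [ite_pow, pow_ite]
  · have hdvd := (Nat.coprime_or_dvd_of_prime hp (a k)).resolve_left hak
    simp only [if_true]
    rw [hp.coprime_iff_not_dvd] at hai ⊢
    rwa [Nat.dvd_add_right hdvd]

theorem mem_closure_of_fixes [Finite G] {p : ℕ} (hp : p.Prime) (hG : IsPGroup p G)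
    (hb : IsOrderedBasis h) (n : ℕ) {φ : MulAut G}
    (hφ : ∀ j : Fin t, j + n < t → φ (h j) = h j) :
    φ ∈ Subgroup.closure (diagAndTransvections G) := by
  induction n generalizing φ with
  | zero =>
    have : φ = 1 := by
      have := hb.monoidHom_ext (f := φ.toMonoidHom) (g := MonoidHom.id G)
        fun i => hφ i i.isLt
      ext y
      exact DFunLike.congr_fun this y
    exact this ▸ one_mem _
  | succ n ih =>
    by_cases hn : n < t
    · obtain ⟨ψ, hψ, hfix⟩ := hb.exists_mem_closure_mul_fixes hp hG ⟨t - 1 - n, by omega⟩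
        fun j hj => hφ j (by
          have : (j : ℕ) < t - 1 - n := hj
          omega)
      refine (Subgroup.mul_mem_cancel_left _ hψ).1 (ih fun j hj => hfix j ?_)
      change (j : ℕ) ≤ t - 1 - n
      omega
    · exact ih fun j hj => by omega

end IsOrderedBasis

/-- Statement (6.3): the automorphism group of a finite abelian `p`-group possessing an
ordered basis of length `t ≥ 2` is generated by the diagonal automorphisms `d(k,m;h)` and
the transvections `t(i,j,s;h)`, taken over all ordered bases `h` of `G`. -/
theorem aut_generated_by_diagonals_and_transvections
    (p : ℕ) (hp : p.Prime) (G : Type*) [CommGroup G] [Finite G] (hG : IsPGroup p G)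
    (hbasis : ∃ (t : ℕ) (h : Fin t → G), 2 ≤ t ∧ IsOrderedBasis h) :
    Subgroup.closure (diagAndTransvections G) = ⊤ := by
  obtain ⟨t, h, -, hb⟩ := hbasis
  exact top_unique fun φ _ => hb.mem_closure_of_fixes hp hG t fun j hj => by omega
end
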